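/- arXiv:2204.10131 — 2 statements merged into one kernel-verified Lean document; each statement's English description precedes it below -/
import Mathlib

section
/- (Equivalence of primal-dual and dual-primal iterations without activation.) Let f : ℝ^p → ℝ^p be any map (playing the role of prox^Σ_J). Define the PD sequences by u_{PD}^{k+1} = u_{PD}^k + Γ(A p̄_{PD}^k − b^δ), x_{PD}^{k+1} = f(x_{PD}^k − Σ Aᵀ u_{PD}^{k+1}), p̄_{PD}^{k+1} = 2x_{PD}^{k+1} − x_{PD}^k (i.e. PDA with T = Id, so p^k = x_{PD}^k), and the DP sequences by x_{DP}^{k+1} = f(x_{DP}^k − Σ Aᵀ q̄_{DP}^k), u_{DP}^{k+1} = q_{DP}^k + Γ(A x_{DP}^{k+1} − b^δ), q̄_{DP}^{k+1} = 2u_{DP}^{k+1} − u_{DP}^k (i.e. DPA with T = Id, so q^k = u_{DP}^k). Suppose the initializations satisfy p_{PD}^0 = p̄_{PD}^0, q_{DP}^0 = q̄_{DP}^0, u_{PD}^0 = q_{DP}^0, and x_{PD}^1 = x_{DP}^1. Then x_{PD}^k = x_{DP}^k for every k ∈ ℕ. -/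
open Matrix

/-- Matrix acting on a Euclidean vector. -/
noncomputable def mApp {m n : ℕ} (M : Matrix (Fin m) (Fin n) ℝ)
    (x : EuclideanSpace ℝ (Fin n)) : EuclideanSpace ℝ (Fin m) :=
  Matrix.toEuclideanLin M x

/-- Equivalence of the primal-dual and dual-primal iterations without activation
(`T = Id`): if the initializations agree (`p⁰_{PD} = p̄⁰_{PD}`, `q⁰_{DP} = q̄⁰_{DP}`,
`u⁰_{PD} = q⁰_{DP}` and `x¹_{PD} = x¹_{DP}`), then the primal sequences coincide. -/
theorem pd_dp_equivalence
    {p d : ℕ}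
    (A : Matrix (Fin d) (Fin p) ℝ) (bδ : EuclideanSpace ℝ (Fin d))
    -- diagonal positive definite preconditioners Σ = diagonal σ, Γ = diagonal γ
    (σ : Fin p → ℝ) (γ : Fin d → ℝ) (hσ : ∀ i, 0 < σ i) (hγ : ∀ i, 0 < γ i)
    -- an arbitrary map playing the role of prox^Σ_J
    (f : EuclideanSpace ℝ (Fin p) → EuclideanSpace ℝ (Fin p))
    -- PD sequences (with T = Id, so p^k = x_{PD}^k)
    (xPD pbarPD : ℕ → EuclideanSpace ℝ (Fin p)) (uPD : ℕ → EuclideanSpace ℝ (Fin d))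
    (huPD : ∀ k, uPD (k + 1) = uPD k + mApp (Matrix.diagonal γ) (mApp A (pbarPD k) - bδ))
    (hxPD : ∀ k, xPD (k + 1) = f (xPD k - mApp (Matrix.diagonal σ) (mApp Aᵀ (uPD (k + 1)))))
    (hpbarPD : ∀ k, pbarPD (k + 1) = (2 : ℝ) • xPD (k + 1) - xPD k)
    -- DP sequences (with T = Id, so q^k = u_{DP}^k)
    (xDP : ℕ → EuclideanSpace ℝ (Fin p)) (uDP qbarDP : ℕ → EuclideanSpace ℝ (Fin d))
    (hxDP : ∀ k, xDP (k + 1) = f (xDP k - mApp (Matrix.diagonal σ) (mApp Aᵀ (qbarDP k))))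
    (huDP : ∀ k, uDP (k + 1) = uDP k + mApp (Matrix.diagonal γ) (mApp A (xDP (k + 1)) - bδ))
    (hqbarDP : ∀ k, qbarDP (k + 1) = (2 : ℝ) • uDP (k + 1) - uDP k)
    -- initializations
    (hinitPD : pbarPD 0 = xPD 0)
    (hinitDP : qbarDP 0 = uDP 0)
    (hinit0 : uPD 0 = uDP 0)
    (hinit1 : xPD 1 = xDP 1) :
    ∀ k : ℕ, 1 ≤ k → xPD k = xDP k := by
  have key : ∀ k, xPD (k + 1) = xDP (k + 1) ∧
      uPD (k + 1) = uDP k + mApp (Matrix.diagonal γ) (mApp A (xPD k) - bδ) := by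
    intro k
    induction k with
    | zero => exact ⟨hinit1, by rw [huPD, hinitPD, hinit0]⟩
    | succ k ih =>
      obtain ⟨hx, hu⟩ := ih
      have hu' : uPD (k + 1 + 1) =
          uDP (k + 1) + mApp (Matrix.diagonal γ) (mApp A (xPD (k + 1)) - bδ) := by
        rw [huPD (k + 1), hu, huDP k, hpbarPD k, ← hx]
        simp only [mApp, map_sub, map_smul]
        module
      refine ⟨?_, hu'⟩
      have hq : qbarDP (k + 1) = uPD (k + 1 + 1) := by
        rw [hu', hqbarDP k, huDP k, hx]
        module
      rw [hxPD (k + 1), hxDP (k + 1), hq, hx]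
  intro k hk
  obtain ⟨n, rfl⟩ := Nat.exists_eq_add_of_le' hk
  exact (key n).1
end

section
/- (Landweber operator satisfies the stability assumption.) Let A ≠ 0 and 0 < α < 2/‖A‖², and define T : ℝ^p → ℝ^p by T x = x − α Aᵀ(A x − b^δ). Then every x with Ax = b^δ is a fixed point of T, and for every x ∈ ℝ^p and every x̄ with A x̄ = b, ‖T x − x̄‖² ≤ ‖x − x̄‖² + (α/(2 − α‖A‖²))·δ². -/
open Matrix

/-- L2 operator norm of a real matrix acting between Euclidean spaces. -/
noncomputable def opNorm {m n : ℕ} (M : Matrix (Fin m) (Fin n) ℝ) : ℝ :=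
  ‖LinearMap.toContinuousLinearMap (Matrix.toEuclideanLin M)‖

theorem mApp_sub {m n : ℕ} (M : Matrix (Fin m) (Fin n) ℝ) (x y : EuclideanSpace ℝ (Fin n)) :
    mApp M (x - y) = mApp M x - mApp M y :=
  map_sub (Matrix.toEuclideanLin M) x y

theorem inner_mApp_transpose {m n : ℕ} (M : Matrix (Fin m) (Fin n) ℝ)
    (x : EuclideanSpace ℝ (Fin n)) (y : EuclideanSpace ℝ (Fin m)) :
    inner ℝ x (mApp Mᵀ y) = inner ℝ (mApp M x) y := by
  rw [mApp, ← Matrix.conjTranspose_eq_transpose_of_trivial,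
    Matrix.toEuclideanLin_conjTranspose_eq_adjoint, LinearMap.adjoint_inner_right, mApp]

theorem norm_mApp_le {m n : ℕ} (M : Matrix (Fin m) (Fin n) ℝ) (x : EuclideanSpace ℝ (Fin n)) :
    ‖mApp M x‖ ≤ opNorm M * ‖x‖ :=
  (LinearMap.toContinuousLinearMap (Matrix.toEuclideanLin M)).le_opNorm x

theorem opNorm_nonneg {m n : ℕ} (M : Matrix (Fin m) (Fin n) ℝ) : 0 ≤ opNorm M :=
  norm_nonneg _

theorem norm_mApp_transpose_le {m n : ℕ} (M : Matrix (Fin m) (Fin n) ℝ)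
    (y : EuclideanSpace ℝ (Fin m)) : ‖mApp Mᵀ y‖ ≤ opNorm M * ‖y‖ := by
  rcases (norm_nonneg (mApp Mᵀ y)).eq_or_lt with h | h
  · rw [← h]
    exact mul_nonneg (opNorm_nonneg M) (norm_nonneg y)
  · refine le_of_mul_le_mul_right ?_ h
    calc ‖mApp Mᵀ y‖ * ‖mApp Mᵀ y‖ = inner ℝ (mApp M (mApp Mᵀ y)) y := by
          rw [← inner_mApp_transpose, real_inner_self_eq_norm_mul_norm]
      _ ≤ ‖mApp M (mApp Mᵀ y)‖ * ‖y‖ := real_inner_le_norm _ _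
      _ ≤ opNorm M * ‖mApp Mᵀ y‖ * ‖y‖ := by gcongr; exact norm_mApp_le M _
      _ = opNorm M * ‖y‖ * ‖mApp Mᵀ y‖ := by ring

/-- The Landweber operator `T x = x − α Aᵀ(Ax − b^δ)` with `0 < α < 2/‖A‖²` satisfies the
stability assumption A3 with `e_T = α/(2 − α‖A‖²)`. -/
theorem landweber_stability
    {p d : ℕ} (A : Matrix (Fin d) (Fin p) ℝ) (hA : A ≠ 0)
    (b bδ : EuclideanSpace ℝ (Fin d)) (δ : ℝ) (hδ : 0 ≤ δ) (hbδ : ‖bδ - b‖ ≤ δ)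
    (α : ℝ) (hα0 : 0 < α) (hα2 : α < 2 / opNorm A ^ 2)
    (T : EuclideanSpace ℝ (Fin p) → EuclideanSpace ℝ (Fin p))
    (hT : ∀ x, T x = x - α • mApp Aᵀ (mApp A x - bδ)) :
    (∀ x : EuclideanSpace ℝ (Fin p), mApp A x = bδ → T x = x) ∧
    (∀ x xbar : EuclideanSpace ℝ (Fin p), mApp A xbar = b →
      ‖T x - xbar‖ ^ 2 ≤ ‖x - xbar‖ ^ 2 + α / (2 - α * opNorm A ^ 2) * δ ^ 2) := by
  have hL : 0 < opNorm A ^ 2 := by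
    refine (sq_nonneg (opNorm A)).lt_of_ne fun h => ?_
    rw [← h, div_zero] at hα2
    exact hα2.not_gt hα0
  have hc : 0 < 2 - α * opNorm A ^ 2 := sub_pos.mpr ((lt_div_iff₀ hL).mp hα2)
  refine ⟨fun x hx => ?_, fun x xbar hxbar => ?_⟩
  · rw [hT, hx, sub_self, mApp, map_zero, smul_zero, sub_zero]
  · set r := mApp A x - bδ with hr
    have hres : mApp A (x - xbar) = r + (bδ - b) := by rw [mApp_sub, hxbar, hr]; abel
    have hinner : ‖r‖ ^ 2 - ‖r‖ * δ ≤ inner ℝ (x - xbar) (mApp Aᵀ r) := by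
      rw [inner_mApp_transpose, hres, inner_add_left, real_inner_self_eq_norm_sq]
      have h₁ : -(‖bδ - b‖ * ‖r‖) ≤ inner ℝ (bδ - b) r :=
        (abs_le.mp (abs_real_inner_le_norm _ _)).1
      have h₂ : ‖bδ - b‖ * ‖r‖ ≤ δ * ‖r‖ := by gcongr
      linarith
    have hadj : ‖mApp Aᵀ r‖ ^ 2 ≤ opNorm A ^ 2 * ‖r‖ ^ 2 := by
      rw [← mul_pow]
      gcongr
      exact norm_mApp_transpose_le A r
    have hexpand : ‖T x - xbar‖ ^ 2 = ‖x - xbar‖ ^ 2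
        - 2 * α * inner ℝ (x - xbar) (mApp Aᵀ r) + α ^ 2 * ‖mApp Aᵀ r‖ ^ 2 := by
      rw [hT, sub_right_comm, norm_sub_sq_real, real_inner_smul_right, norm_smul, mul_pow,
        Real.norm_eq_abs, sq_abs]
      ring
    have hsquare : 2 * δ * ‖r‖ - (2 - α * opNorm A ^ 2) * ‖r‖ ^ 2
        ≤ δ ^ 2 / (2 - α * opNorm A ^ 2) := by
      rw [le_div_iff₀ hc]
      linarith [sq_nonneg (δ - (2 - α * opNorm A ^ 2) * ‖r‖)]
    calc ‖T x - xbar‖ ^ 2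
        ≤ ‖x - xbar‖ ^ 2 - 2 * α * (‖r‖ ^ 2 - ‖r‖ * δ)
          + α ^ 2 * (opNorm A ^ 2 * ‖r‖ ^ 2) := by rw [hexpand]; gcongr
      _ = ‖x - xbar‖ ^ 2
          + α * (2 * δ * ‖r‖ - (2 - α * opNorm A ^ 2) * ‖r‖ ^ 2) := by ring
      _ ≤ ‖x - xbar‖ ^ 2 + α * (δ ^ 2 / (2 - α * opNorm A ^ 2)) := by gcongr
      _ = ‖x - xbar‖ ^ 2 + α / (2 - α * opNorm A ^ 2) * δ ^ 2 := by ring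
end
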